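/- Let A = k[x,y,u,v]/(xy, uv) over a field k. Then the module Ext¹(Ω¹_{A/k}, A) is isomorphic to k[u,v]/(uv) ⊕ k[x,y]/(xy) as an A-module, where A acts on the first summand through A → k[u,v]/(uv) (setting x = y = 0) and on the second through A → k[x,y]/(xy) (setting u = v = 0). -/

import Mathlib

open CategoryTheory MvPolynomial

/-- The ring `A = k[x,y,u,v]/(xy, uv)` (variables `x = X 0`, `y = X 1`, `u = X 2`,
`v = X 3`). -/
abbrev A17 (k : Type) [Field k] : Type :=
  MvPolynomial (Fin 4) k ⧸
    Ideal.span {(X 0 * X 1 : MvPolynomial (Fin 4) k), X 2 * X 3}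

set_option synthInstance.maxHeartbeats 1000000

namespace ModuleCat

universe u

variable {R : Type u} [CommRing R]

/-- The objects of the two-term complex `P₁ ⟶ P₀` in degrees `1` and `0`. -/
def twoTermX (P₁ P₀ : ModuleCat.{u} R) : ℕ → ModuleCat.{u} R
  | 0 => P₀
  | 1 => P₁
  | _ + 2 => ModuleCat.of R PUnit

/-- The differentials of the two-term complex `P₁ ⟶ P₀` in degrees `1` and `0`. -/
def twoTermD {P₁ P₀ : ModuleCat.{u} R} (d : P₁ ⟶ P₀) :
    ∀ n, twoTermX P₁ P₀ (n + 1) ⟶ twoTermX P₁ P₀ n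
  | 0 => d
  | _ + 1 => 0

/-- The two-term complex `P₁ ⟶ P₀` in degrees `1` and `0`. -/
noncomputable def twoTerm {P₁ P₀ : ModuleCat.{u} R} (d : P₁ ⟶ P₀) :
    ChainComplex (ModuleCat.{u} R) ℕ :=
  ChainComplex.of (twoTermX P₁ P₀) (twoTermD d) fun n => by
    cases n <;> exact Limits.zero_comp

lemma twoTerm_d_one_zero {P₁ P₀ : ModuleCat.{u} R} (d : P₁ ⟶ P₀) :
    (twoTerm d).d 1 0 = d :=
  ChainComplex.of_d (twoTermX P₁ P₀) (twoTermD d) 0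

lemma twoTerm_d_succ {P₁ P₀ : ModuleCat.{u} R} (d : P₁ ⟶ P₀) (n : ℕ) :
    (twoTerm d).d (n + 2) (n + 1) = 0 :=
  ChainComplex.of_d (twoTermX P₁ P₀) (twoTermD d) (n + 1)

/-- The projective resolution given by a short exact sequence `0 ⟶ P₁ ⟶ P₀ ⟶ M ⟶ 0`
with `P₁` and `P₀` projective. -/
noncomputable def twoTermResolution {M P₁ P₀ : ModuleCat.{u} R} [Projective P₁] [Projective P₀]
    (d : P₁ ⟶ P₀) (p : P₀ ⟶ M) (hd : Function.Injective d) (hdp : Function.Exact d p)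
    (hp : Function.Surjective p) : ProjectiveResolution M where
  complex := twoTerm d
  projective := by
    rintro (_ | _ | n)
    · exact inferInstanceAs (Projective P₀)
    · exact inferInstanceAs (Projective P₁)
    · exact (ModuleCat.isZero_of_subsingleton (ModuleCat.of R PUnit)).projective
  π := (ChainComplex.toSingle₀Equiv _ _).symm ⟨p, by
    rw [twoTerm_d_one_zero]
    ext a
    exact hdp.apply_apply_eq_zero a⟩
  quasiIso := ⟨fun n => by
    cases n with
    | zero =>
      rw [ChainComplex.quasiIsoAt₀_iff, ShortComplex.quasiIso_iff_of_zeros']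
      · have hdp0 : d ≫ p = 0 := by
          ext a
          exact hdp.apply_apply_eq_zero a
        refine (ShortComplex.exact_and_epi_g_iff_of_iso (S₂ := ShortComplex.mk d p hdp0) ?_).2
          ⟨ModuleCat.shortComplex_exact _ hdp, (ModuleCat.epi_iff_surjective _).2 hp⟩
        exact ShortComplex.isoMk (Iso.refl _) (Iso.refl _) (Iso.refl _)
          (by simp [twoTerm_d_one_zero]; rfl) (by simp; rfl)
      all_goals rfl
    | succ n =>
      rw [quasiIsoAt_iff_exactAt' _ _ (ChainComplex.exactAt_succ_single_obj _ _),
        HomologicalComplex.exactAt_iff' _ (n + 2) (n + 1) n (by simp) (by simp)]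
      cases n with
      | zero =>
        have : Mono d := (ModuleCat.mono_iff_injective d).2 hd
        refine (ShortComplex.exact_iff_mono _ (twoTerm_d_succ d 0)).2 ?_
        change Mono ((twoTerm d).d 1 0)
        rw [twoTerm_d_one_zero]
        exact this
      | succ n =>
        exact ShortComplex.exact_of_isZero_X₂ _
          (ModuleCat.isZero_of_subsingleton (ModuleCat.of R PUnit))⟩

theorem nonempty_ext_one_iso {M P₁ P₀ : ModuleCat.{u} R} [Projective P₁] [Projective P₀]
    (d : P₁ ⟶ P₀) (p : P₀ ⟶ M) (hd : Function.Injective d) (hdp : Function.Exact d p)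
    (hp : Function.Surjective p) (N Q : ModuleCat.{u} R) (Φ : (P₁ ⟶ N) →ₗ[R] Q)
    (hΦ : Function.Surjective Φ) (hker : ∀ φ, Φ φ = 0 ↔ ∃ ψ : P₀ ⟶ N, d ≫ ψ = φ) :
    Nonempty (((Ext R (ModuleCat.{u} R) 1).obj (Opposite.op M)).obj N ≅ Q) := by
  let K := (twoTerm d).linearYonedaObj R N
  have hg : (K.sc' 0 1 2).g = 0 := by
    ext f
    exact (congrArg (· ≫ f) (twoTerm_d_succ d 0)).trans Limits.zero_comp
  have := (K.sc' 0 1 2).isIso_homologyι hg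
  refine ⟨(twoTermResolution d p hd hdp hp).isoExt 1 N ≪≫
    K.homologyIsoSc' 0 1 2 (by simp) (by simp) ≪≫ asIso (K.sc' 0 1 2).homologyι ≪≫
    (K.sc' 0 1 2).moduleCatOpcyclesIso ≪≫ LinearEquiv.toModuleIso
      (Submodule.quotEquivOfEq _ (LinearMap.ker Φ) ?_ ≪≫ₗ Φ.quotKerEquivOfSurjective hΦ)⟩
  ext φ
  refine Iff.trans ?_ (hker φ).symm
  refine exists_congr fun ψ => ?_
  rw [← twoTerm_d_one_zero d]
  rfl

end ModuleCat

namespace MvPolynomial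

variable {k σ : Type*} [Field k]

/-- The gradient of a polynomial, reduced modulo an ideal `I` and a submodule `N`. -/
noncomputable def gradientMkQ (I : Ideal (MvPolynomial σ k))
    (N : Submodule (MvPolynomial σ k ⧸ I) (σ → MvPolynomial σ k ⧸ I)) :
    MvPolynomial σ k →ₗ[k] (σ → MvPolynomial σ k ⧸ I) ⧸ N :=
  N.mkQ.restrictScalars k ∘ₗ LinearMap.pi fun i =>
    (Ideal.Quotient.mkₐ k I).toLinearMap ∘ₗ (pderiv i).toLinearMap

lemma gradientMkQ_apply (I : Ideal (MvPolynomial σ k))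
    (N : Submodule (MvPolynomial σ k ⧸ I) (σ → MvPolynomial σ k ⧸ I)) (f : MvPolynomial σ k) :
    gradientMkQ I N f = N.mkQ fun i => Ideal.Quotient.mk I (pderiv i f) :=
  rfl

lemma gradientMkQ_mul (I : Ideal (MvPolynomial σ k))
    (N : Submodule (MvPolynomial σ k ⧸ I) (σ → MvPolynomial σ k ⧸ I)) (f g : MvPolynomial σ k) :
    gradientMkQ I N (f * g) =
      Ideal.Quotient.mk I f • gradientMkQ I N g + Ideal.Quotient.mk I g • gradientMkQ I N f := by
  simp only [gradientMkQ_apply, ← map_smul, ← map_add]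
  congr 1
  ext i
  simp

lemma gradientMkQ_eq_zero (s : Set (MvPolynomial σ k))
    (N : Submodule (MvPolynomial σ k ⧸ Ideal.span s) (σ → MvPolynomial σ k ⧸ Ideal.span s))
    (hN : ∀ f ∈ s, (fun i => Ideal.Quotient.mk (Ideal.span s) (pderiv i f)) ∈ N)
    {f : MvPolynomial σ k} (hf : f ∈ Ideal.span s) : gradientMkQ (Ideal.span s) N f = 0 := by
  induction hf using Submodule.span_induction with
  | mem f hf => exact (Submodule.Quotient.mk_eq_zero N).2 (hN f hf)
  | zero => exact map_zero _
  | add f g _ _ hf hg => rw [map_add, hf, hg, add_zero]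
  | smul a f hf ih =>
    have hfa : Ideal.Quotient.mk (Ideal.span s) f •
        (fun i => Ideal.Quotient.mk (Ideal.span s) (pderiv i a)) = 0 := by
      ext i
      rw [Pi.smul_apply, smul_eq_mul, Ideal.Quotient.eq_zero_iff_mem.2 hf, zero_mul,
        Pi.zero_apply]
    rw [smul_eq_mul, gradientMkQ_mul, ih, smul_zero, zero_add, gradientMkQ_apply, ← map_smul,
      hfa, map_zero]

/-- Modulo a submodule containing the gradients of the relations, the gradient is a derivation
on a quotient of a polynomial ring. -/
noncomputable def gradientDerivation (s : Set (MvPolynomial σ k))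
    (N : Submodule (MvPolynomial σ k ⧸ Ideal.span s) (σ → MvPolynomial σ k ⧸ Ideal.span s))
    (hN : ∀ f ∈ s, (fun i => Ideal.Quotient.mk (Ideal.span s) (pderiv i f)) ∈ N) :
    Derivation k (MvPolynomial σ k ⧸ Ideal.span s)
      ((σ → MvPolynomial σ k ⧸ Ideal.span s) ⧸ N) :=
  Derivation.mk' ((Submodule.restrictScalars k (Ideal.span s)).liftQ
    (gradientMkQ (Ideal.span s) N) fun _ hf => gradientMkQ_eq_zero s N hN hf) <| by
    intro a b
    obtain ⟨f, rfl⟩ := Ideal.Quotient.mk_surjective a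
    obtain ⟨g, rfl⟩ := Ideal.Quotient.mk_surjective b
    exact gradientMkQ_mul (Ideal.span s) N f g

lemma gradientDerivation_mk (s : Set (MvPolynomial σ k))
    (N : Submodule (MvPolynomial σ k ⧸ Ideal.span s) (σ → MvPolynomial σ k ⧸ Ideal.span s))
    (hN : ∀ f ∈ s, (fun i => Ideal.Quotient.mk (Ideal.span s) (pderiv i f)) ∈ N)
    (f : MvPolynomial σ k) :
    gradientDerivation s N hN (Ideal.Quotient.mk _ f) =
      N.mkQ fun i => Ideal.Quotient.mk (Ideal.span s) (pderiv i f) :=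
  rfl

variable [Fintype σ]

/-- The presentation map of the module of differentials of a quotient of a polynomial ring,
sending basis vectors to the differentials of the variables. -/
noncomputable def toKaehlerQuotient (I : Ideal (MvPolynomial σ k)) :
    (σ → MvPolynomial σ k ⧸ I) →ₗ[MvPolynomial σ k ⧸ I]
      KaehlerDifferential k (MvPolynomial σ k ⧸ I) :=
  Fintype.linearCombination _ fun i => KaehlerDifferential.D k _ (Ideal.Quotient.mk I (X i))

lemma D_mk_eq_toKaehlerQuotient (I : Ideal (MvPolynomial σ k)) (f : MvPolynomial σ k) :
    KaehlerDifferential.D k (MvPolynomial σ k ⧸ I) (Ideal.Quotient.mk I f) =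
      toKaehlerQuotient I fun i => Ideal.Quotient.mk I (pderiv i f) := by
  classical
  induction f using MvPolynomial.induction_on with
  | C a =>
    simp only [pderiv_C, map_zero]
    exact (Derivation.map_algebraMap _ a).trans (map_zero _).symm
  | add f g hf hg =>
    rw [map_add, map_add, hf, hg, ← map_add]
    congr 1
    ext i
    simp
  | mul_X f j hf =>
    have : (fun i => Ideal.Quotient.mk I (pderiv i (f * X j))) =
        Ideal.Quotient.mk I f • Pi.single j 1 +
          Ideal.Quotient.mk I (X j) • fun i => Ideal.Quotient.mk I (pderiv i f) := by
      ext i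
      by_cases h : j = i
      · subst h; simp
      · simp [h, pderiv_X_of_ne h]
    rw [map_mul, Derivation.leibniz, hf, this, map_add, map_smul, map_smul]
    simp [toKaehlerQuotient, Fintype.linearCombination_apply_single]

lemma toKaehlerQuotient_surjective (I : Ideal (MvPolynomial σ k)) :
    Function.Surjective (toKaehlerQuotient I) := by
  rw [← LinearMap.range_eq_top, eq_top_iff, ← KaehlerDifferential.span_range_derivation,
    Submodule.span_le]
  rintro _ ⟨a, rfl⟩
  obtain ⟨f, rfl⟩ := Ideal.Quotient.mk_surjective a
  exact ⟨_, (D_mk_eq_toKaehlerQuotient I f).symm⟩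

/-- The kernel of the presentation map of the module of differentials is generated by the
gradients of the relations. -/
lemma ker_toKaehlerQuotient (s : Set (MvPolynomial σ k)) :
    LinearMap.ker (toKaehlerQuotient (Ideal.span s)) =
      Submodule.span (MvPolynomial σ k ⧸ Ideal.span s)
        ((fun f i => Ideal.Quotient.mk (Ideal.span s) (pderiv i f)) '' s) := by
  classical
  apply le_antisymm
  · set N := Submodule.span (MvPolynomial σ k ⧸ Ideal.span s)
        ((fun f i => Ideal.Quotient.mk (Ideal.span s) (pderiv i f)) '' s)
    let δ := gradientDerivation s N fun f hf => Submodule.subset_span ⟨f, hf, rfl⟩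
    have key : δ.liftKaehlerDifferential ∘ₗ toKaehlerQuotient (Ideal.span s) = N.mkQ := by
      refine LinearMap.pi_ext' fun j => LinearMap.ext_ring ?_
      simp only [LinearMap.comp_apply, LinearMap.single_apply, toKaehlerQuotient,
        Fintype.linearCombination_apply_single, one_smul, Derivation.liftKaehlerDifferential_comp_D]
      refine (gradientDerivation_mk s N _ (X j)).trans (congrArg _ ?_)
      ext i
      by_cases h : j = i
      · subst h; simp
      · simp [pderiv_X_of_ne h, Pi.single_eq_of_ne' h]
    intro c hc
    rw [← N.ker_mkQ, ← key, LinearMap.mem_ker, LinearMap.comp_apply, LinearMap.mem_ker.1 hc,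
      map_zero]
  · rw [Submodule.span_le]
    rintro _ ⟨f, hf, rfl⟩
    rw [SetLike.mem_coe, LinearMap.mem_ker, ← D_mk_eq_toKaehlerQuotient,
      Ideal.Quotient.eq_zero_iff_mem.2 (Ideal.subset_span hf), map_zero]

/-- For distinct pairs of variables, no polynomial outside `(X a X b, X c X d)` is multiplied
into that ideal by both `X a` and `X b`. -/
lemma mem_span_pair_of_mul_mem {k σ : Type*} [CommRing k] {a b c d : σ} (hab : a ≠ b)
    (hac : a ≠ c) (had : a ≠ d) (hbc : b ≠ c) (hbd : b ≠ d) (hcd : c ≠ d)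
    {f : MvPolynomial σ k}
    (ha : f * X a ∈ Ideal.span {(X a * X b : MvPolynomial σ k), X c * X d})
    (hb : f * X b ∈ Ideal.span {(X a * X b : MvPolynomial σ k), X c * X d}) :
    f ∈ Ideal.span {(X a * X b : MvPolynomial σ k), X c * X d} := by
  classical
  have hs : ({(X a * X b : MvPolynomial σ k), X c * X d} : Set (MvPolynomial σ k)) =
      (fun s => monomial s (1 : k)) '' {Finsupp.single a 1 + Finsupp.single b 1,
        Finsupp.single c 1 + Finsupp.single d 1} := by
    simp [Set.image_pair, X, monomial_mul]
  have hle {p q : σ} (hpq : p ≠ q) (m : σ →₀ ℕ) :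
      Finsupp.single p 1 + Finsupp.single q 1 ≤ m ↔ 1 ≤ m p ∧ 1 ≤ m q := by
    refine ⟨fun h => ⟨?_, ?_⟩, fun h i => ?_⟩
    · simpa [hpq] using h p
    · simpa [hpq.symm] using h q
    · by_cases hp : p = i
      · subst hp; simpa [hpq] using h.1
      · by_cases hq : q = i
        · subst hq; simpa [hpq] using h.2
        · simp [Finsupp.single_eq_of_ne' hp, Finsupp.single_eq_of_ne' hq]
  rw [hs, mem_ideal_span_monomial_image] at ha hb ⊢
  intro m hm
  have ha' := ha (m + Finsupp.single a 1) (by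
    rw [mem_support_iff, coeff_mul_X]; exact mem_support_iff.1 hm)
  have hb' := hb (m + Finsupp.single b 1) (by
    rw [mem_support_iff, coeff_mul_X]; exact mem_support_iff.1 hm)
  simp only [Set.mem_insert_iff, Set.mem_singleton_iff, exists_eq_or_imp, exists_eq_left,
    hle hab, hle hcd, Finsupp.add_apply, Finsupp.single_apply] at ha' hb' ⊢
  simp only [hab, hab.symm, hac, had, hbc, hbd, if_true, if_false] at ha' hb'
  omega

end MvPolynomial

section

universe u

variable {R : Type u} [CommRing R]

/-- The map `R² → R⁴` whose columns are the gradients of `xy` and `uv`. -/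
def jacobianMap (x y u v : R) : R × R →ₗ[R] Fin 4 → R :=
  (LinearMap.toSpanSingleton R (Fin 4 → R) ![y, x, 0, 0]).coprod
    (LinearMap.toSpanSingleton R (Fin 4 → R) ![0, 0, v, u])

lemma jacobianMap_apply (x y u v a b : R) :
    jacobianMap x y u v (a, b) = ![a * y, a * x, b * v, b * u] := by
  ext i
  fin_cases i <;> simp [jacobianMap]

lemma jacobianMap_injective {x y u v : R} (hxy : ∀ a, a * x = 0 → a * y = 0 → a = 0)
    (huv : ∀ a, a * u = 0 → a * v = 0 → a = 0) :
    Function.Injective (jacobianMap x y u v) := by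
  rw [injective_iff_map_eq_zero]
  rintro ⟨a, b⟩ h
  rw [jacobianMap_apply] at h
  exact Prod.ext (hxy a (congrFun h 1) (congrFun h 0)) (huv b (congrFun h 3) (congrFun h 2))

/-- Evaluation of a linear form on `R²` at the standard basis, modulo `(x, y)` and `(u, v)`. -/
def evalBasisQuotient (x y u v : R) :
    (R × R →ₗ[R] R) →ₗ[R] (R ⧸ Ideal.span {x, y}) × (R ⧸ Ideal.span {u, v}) :=
  ((Ideal.span {x, y}).mkQ ∘ₗ LinearMap.applyₗ (1, 0)).prod
    ((Ideal.span {u, v}).mkQ ∘ₗ LinearMap.applyₗ (0, 1))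

lemma evalBasisQuotient_surjective (x y u v : R) :
    Function.Surjective (evalBasisQuotient x y u v) := by
  rintro ⟨a, b⟩
  obtain ⟨a, rfl⟩ := Submodule.mkQ_surjective _ a
  obtain ⟨b, rfl⟩ := Submodule.mkQ_surjective _ b
  refine ⟨(LinearMap.toSpanSingleton R R a).coprod (LinearMap.toSpanSingleton R R b), ?_⟩
  simp [evalBasisQuotient]

lemma evalBasisQuotient_eq_zero_iff (x y u v : R) (φ : R × R →ₗ[R] R) :
    evalBasisQuotient x y u v φ = 0 ↔
      ∃ ψ : (Fin 4 → R) →ₗ[R] R, ψ ∘ₗ jacobianMap x y u v = φ := by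
  have h : evalBasisQuotient x y u v φ = 0 ↔
      φ (1, 0) ∈ Ideal.span {x, y} ∧ φ (0, 1) ∈ Ideal.span {u, v} := by
    rw [Prod.ext_iff]
    exact and_congr (Submodule.Quotient.mk_eq_zero _) (Submodule.Quotient.mk_eq_zero _)
  rw [h, Ideal.mem_span_pair, Ideal.mem_span_pair]
  constructor
  · rintro ⟨⟨a, b, hab⟩, c, d, hcd⟩
    refine ⟨Fintype.linearCombination R ![b, a, d, c], ?_⟩
    ext
    · simp [jacobianMap_apply, Fintype.linearCombination_apply, Fin.sum_univ_four, ← hab]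
      ring
    · simp [jacobianMap_apply, Fintype.linearCombination_apply, Fin.sum_univ_four, ← hcd]
      ring
  · rintro ⟨ψ, rfl⟩
    have hψ (w : Fin 4 → R) : ψ w = ∑ i, w i * ψ (Pi.single i 1) := by
      conv_lhs => rw [pi_eq_sum_univ' w, map_sum]
      simp
    refine ⟨⟨ψ (Pi.single 1 1), ψ (Pi.single 0 1), ?_⟩, ψ (Pi.single 3 1), ψ (Pi.single 2 1), ?_⟩
    · rw [LinearMap.comp_apply, jacobianMap_apply, hψ ![1 * y, 1 * x, 0 * v, 0 * u], Fin.sum_univ_four]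
      simp
      ring
    · rw [LinearMap.comp_apply, jacobianMap_apply, hψ ![0 * y, 0 * x, 1 * v, 1 * u], Fin.sum_univ_four]
      simp
      ring

/-- `Ext¹(M, R)` for a module `M` with free resolution `0 → R² → R⁴ → M → 0` given by the
gradients of `xy` and `uv`. -/
theorem nonempty_ext_one_iso_of_exact_jacobianMap {M : Type u} [AddCommGroup M] [Module R M]
    {x y u v : R} (p : (Fin 4 → R) →ₗ[R] M) (hp : Function.Surjective p)
    (hker : Function.Exact (jacobianMap x y u v) p)
    (hxy : ∀ a, a * x = 0 → a * y = 0 → a = 0) (huv : ∀ a, a * u = 0 → a * v = 0 → a = 0) :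
    Nonempty ((((Ext R (ModuleCat.{u} R) 1).obj (Opposite.op (ModuleCat.of R M))).obj
      (ModuleCat.of R R)) ≅
        ModuleCat.of R ((R ⧸ Ideal.span {x, y}) × (R ⧸ Ideal.span {u, v}))) := by
  have : Projective (ModuleCat.of R (R × R)) :=
    ModuleCat.projective_of_free (Module.Free.chooseBasis R (R × R))
  have : Projective (ModuleCat.of R (Fin 4 → R)) :=
    ModuleCat.projective_of_free (Pi.basisFun R (Fin 4))
  refine ModuleCat.nonempty_ext_one_iso (ModuleCat.ofHom (jacobianMap x y u v))
    (ModuleCat.ofHom p) (jacobianMap_injective hxy huv) hker hp (ModuleCat.of R R) _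
    (evalBasisQuotient x y u v ∘ₗ ModuleCat.homLinearEquiv.toLinearMap)
    ((evalBasisQuotient_surjective x y u v).comp ModuleCat.homLinearEquiv.surjective) fun φ => ?_
  refine (evalBasisQuotient_eq_zero_iff x y u v φ.hom).trans ⟨?_, ?_⟩
  · rintro ⟨ψ, hψ⟩
    exact ⟨ModuleCat.ofHom ψ, ModuleCat.hom_ext hψ⟩
  · rintro ⟨ψ, rfl⟩
    exact ⟨ψ.hom, rfl⟩

end

/-- for `A = k[x,y,u,v]/(xy, uv)`, the `A`-module `Ext¹(Ω¹_{A/k}, A)` is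
isomorphic to `k[u,v]/(uv) ⊕ k[x,y]/(xy) = A/(x,y) ⊕ A/(u,v)`, where `A` acts on the
summands through the quotient maps. -/
theorem stmt17 (k : Type) [Field k]
    (x y u v : A17 k)
    (hx : x = Ideal.Quotient.mk _ (X 0))
    (hy : y = Ideal.Quotient.mk _ (X 1))
    (hu : u = Ideal.Quotient.mk _ (X 2))
    (hv : v = Ideal.Quotient.mk _ (X 3)) :
    Nonempty
      ((((Ext (A17 k) (ModuleCat (A17 k)) 1).obj
            (Opposite.op (ModuleCat.of (A17 k) (KaehlerDifferential k (A17 k))))).obj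
          (ModuleCat.of (A17 k) (A17 k))) ≅
        ModuleCat.of (A17 k)
          ((A17 k ⧸ Ideal.span {x, y}) × (A17 k ⧸ Ideal.span {u, v}))) := by
  subst hx hy hu hv
  set I := Ideal.span {(X 0 * X 1 : MvPolynomial (Fin 4) k), X 2 * X 3}
  refine nonempty_ext_one_iso_of_exact_jacobianMap (toKaehlerQuotient I)
    (toKaehlerQuotient_surjective I) ?_ ?_ ?_
  · rw [LinearMap.exact_iff, ker_toKaehlerQuotient, Set.image_pair, jacobianMap,
      LinearMap.range_coprod, LinearMap.range_toSpanSingleton, LinearMap.range_toSpanSingleton,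
      Submodule.span_insert]
    congr 3
    · ext i
      fin_cases i <;> simp [pderiv_X]
    · ext i
      fin_cases i <;> simp [pderiv_X]
  · intro a
    obtain ⟨f, rfl⟩ := Ideal.Quotient.mk_surjective a
    simp only [← map_mul, Ideal.Quotient.eq_zero_iff_mem]
    exact mem_span_pair_of_mul_mem (by decide) (by decide) (by decide) (by decide) (by decide)
      (by decide)
  · intro a
    obtain ⟨f, rfl⟩ := Ideal.Quotient.mk_surjective a
    simp only [← map_mul, Ideal.Quotient.eq_zero_iff_mem]
    rw [Set.pair_comm]
    exact mem_span_pair_of_mul_mem (by decide) (by decide) (by decide) (by decide) (by decide)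
      (by decide)
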